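/- Let A ∈ ℝ^{m×n} have all rows nonzero, b ∈ ℝ^m, x⋆ ∈ ℝⁿ with A x⋆ = b, and x ∈ ℝⁿ with x ≠ x⋆. Let r = b − Ax, let I ⊆ {1,…,m} be a nonempty index set with r^{(i)} ≠ 0 for all i ∈ I, and define for i ∈ I the weights d_i = |r^{(i)}|²/‖A^{(i)}‖₂², the probabilities p_i = d_i / Σ_{j∈I} d_j, and the Kaczmarz updates x'(i) = x + (r^{(i)}/‖A^{(i)}‖₂²)(A^{(i)})ᵀ. Then Σ_{i∈I} p_i ‖x'(i) − x⋆‖₂² = ‖x − x⋆‖₂² − Σ_{i∈I} p_i |r^{(i)}|²/‖A^{(i)}‖₂², and consequently Σ_{i∈I} p_i ‖x'(i) − x⋆‖₂² ≤ ‖x − x⋆‖₂² − (1/max_{i∈I}‖A^{(i)}‖₂²) Σ_{i∈I} p_i |r^{(i)}|². -/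

import Mathlib

open Matrix

/-- squared Euclidean norm of the `i`-th row of `A` -/
noncomputable def rowSq {m n : ℕ} (A : Matrix (Fin m) (Fin n) ℝ) (i : Fin m) : ℝ :=
  ∑ j, (A i j) ^ 2

/-- `i`-th entry of the residual `b - Ax` -/
noncomputable def res {m n : ℕ} (A : Matrix (Fin m) (Fin n) ℝ) (b : Fin m → ℝ)
    (x : Fin n → ℝ) (i : Fin m) : ℝ :=
  b i - A.mulVec x i

/-- Kaczmarz update of `x` using row `i`:
`x + ((b⁽ⁱ⁾ - A⁽ⁱ⁾x)/‖A⁽ⁱ⁾‖₂²)(A⁽ⁱ⁾)ᵀ`. -/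
noncomputable def kUpd {m n : ℕ} (A : Matrix (Fin m) (Fin n) ℝ) (b : Fin m → ℝ)
    (x : Fin n → ℝ) (i : Fin m) : Fin n → ℝ :=
  x + (res A b x i / rowSq A i) • (fun j => A i j)

/-- GRMK selection probability of row `i ∈ I`: `d_i / Σ_{j∈I} d_j` with
`d_i = |r⁽ⁱ⁾|²/‖A⁽ⁱ⁾‖₂²`. -/
noncomputable def grmkProb {m n : ℕ} (A : Matrix (Fin m) (Fin n) ℝ) (b : Fin m → ℝ)
    (x : Fin n → ℝ) (I : Finset (Fin m)) (i : Fin m) : ℝ :=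
  ((res A b x i) ^ 2 / rowSq A i) / ∑ j ∈ I, (res A b x j) ^ 2 / rowSq A j

/-- the conditional expectation of the squared error after one GRMK step
equals `‖x - x⋆‖₂² - Σ_{i∈I} p_i |r⁽ⁱ⁾|²/‖A⁽ⁱ⁾‖₂²`, and consequently is at most
`‖x - x⋆‖₂² - (1/max_{i∈I}‖A⁽ⁱ⁾‖₂²) Σ_{i∈I} p_i |r⁽ⁱ⁾|²`. -/
theorem grmk_one_step_expectation (m n : ℕ)
    (A : Matrix (Fin m) (Fin n) ℝ)
    (hA : ∀ i, (fun j => A i j) ≠ 0)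
    (b : Fin m → ℝ) (xs : Fin n → ℝ) (hxs : A.mulVec xs = b)
    (x : Fin n → ℝ) (hx : x ≠ xs)
    (I : Finset (Fin m)) (hIne : I.Nonempty)
    (hrI : ∀ i ∈ I, res A b x i ≠ 0)
    (Mx : ℝ) (hMx : IsGreatest ((fun i => rowSq A i) '' (I : Set (Fin m))) Mx) :
    (∑ i ∈ I, grmkProb A b x I i * ∑ j, (kUpd A b x i j - xs j) ^ 2
        = ∑ j, (x j - xs j) ^ 2
          - ∑ i ∈ I, grmkProb A b x I i * ((res A b x i) ^ 2 / rowSq A i)) ∧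
    (∑ i ∈ I, grmkProb A b x I i * ∑ j, (kUpd A b x i j - xs j) ^ 2
        ≤ ∑ j, (x j - xs j) ^ 2
          - (1 / Mx) * ∑ i ∈ I, grmkProb A b x I i * (res A b x i) ^ 2) := by
  have hpos : ∀ i, 0 < rowSq A i := by
    intro i
    obtain ⟨j, hj⟩ := Function.ne_iff.mp (hA i)
    have hj' : A i j ≠ 0 := hj
    exact Finset.sum_pos' (fun k _ => sq_nonneg _) ⟨j, Finset.mem_univ j, by positivity⟩
  have hd : ∀ i ∈ I, 0 < (res A b x i) ^ 2 / rowSq A i := by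
    intro i hi
    have h1 := hpos i
    have h2 := hrI i hi
    positivity
  have hS : 0 < ∑ j ∈ I, (res A b x j) ^ 2 / rowSq A j := Finset.sum_pos hd hIne
  have hp : ∀ i ∈ I, 0 ≤ grmkProb A b x I i := fun i hi => (div_pos (hd i hi) hS).le
  have hp1 : ∑ i ∈ I, grmkProb A b x I i = 1 := by
    unfold grmkProb
    rw [← Finset.sum_div, div_self hS.ne']
  have hstep : ∀ i, ∑ j, (kUpd A b x i j - xs j) ^ 2
      = ∑ j, (x j - xs j) ^ 2 - (res A b x i) ^ 2 / rowSq A i := by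
    intro i
    have hr : ∑ j, A i j * (x j - xs j) = - res A b x i := by
      simp only [res, ← hxs, Matrix.mulVec, dotProduct, mul_sub, Finset.sum_sub_distrib]
      ring
    have hq : ∑ j, (A i j) ^ 2 = rowSq A i := rfl
    have hne := (hpos i).ne'
    have key : ∀ c : ℝ, ∑ j, (x j + c * A i j - xs j) ^ 2
        = ∑ j, (x j - xs j) ^ 2 + 2 * c * (- res A b x i) + c ^ 2 * rowSq A i := by
      intro c
      rw [← hr, ← hq, Finset.mul_sum, Finset.mul_sum, ← Finset.sum_add_distrib,
        ← Finset.sum_add_distrib]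
      exact Finset.sum_congr rfl fun j _ => by ring
    have := key (res A b x i / rowSq A i)
    simp only [kUpd, Pi.add_apply, Pi.smul_apply, smul_eq_mul]
    rw [this]
    field_simp
    ring
  have heq : ∑ i ∈ I, grmkProb A b x I i * ∑ j, (kUpd A b x i j - xs j) ^ 2
        = ∑ j, (x j - xs j) ^ 2
          - ∑ i ∈ I, grmkProb A b x I i * ((res A b x i) ^ 2 / rowSq A i) := by
    simp only [hstep, mul_sub, Finset.sum_sub_distrib, ← Finset.sum_mul, hp1, one_mul]
  refine ⟨heq, ?_⟩
  rw [heq, Finset.mul_sum]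
  refine sub_le_sub_left (Finset.sum_le_sum fun i hi => ?_) _
  have hle : rowSq A i ≤ Mx := hMx.2 ⟨i, hi, rfl⟩
  have h1 : (res A b x i) ^ 2 / Mx ≤ (res A b x i) ^ 2 / rowSq A i :=
    div_le_div_of_nonneg_left (sq_nonneg _) (hpos i) hle
  calc 1 / Mx * (grmkProb A b x I i * (res A b x i) ^ 2)
      = grmkProb A b x I i * ((res A b x i) ^ 2 / Mx) := by ring
    _ ≤ _ := mul_le_mul_of_nonneg_left h1 (hp i hi)
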